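/- arXiv:1209.2374 — 13 statements merged into one kernel-verified Lean document; each statement's English description precedes it below -/
import Mathlib

section
/- A natural number p > 1 is prime if and only if for every natural number n, p divides C(n,p) − ⌊n/p⌋, where C(n,p) is the binomial coefficient and ⌊n/p⌋ is the integer floor of n/p. -/
theorem asc_modEq_aux (p r : ℕ) : (p + 1).ascFactorial r ≡ r.factorial [MOD p] := by
  induction r with
  | zero => rfl
  | succ r ih =>
    rw [Nat.ascFactorial_succ, Nat.factorial_succ]
    refine Nat.ModEq.mul ?_ ih
    rw [add_assoc, add_comm 1 r]
    exact Nat.add_modEq_left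

theorem prime_iff_forall_choose_sub_floor_div
    (p : ℕ) (hp : 1 < p) :
    p.Prime ↔ ∀ n : ℕ, (p : ℤ) ∣ (n.choose p : ℤ) - (n / p : ℕ) := by
  constructor
  · intro h n
    haveI := Fact.mk h
    have := Choose.choose_modEq_choose_mod_mul_choose_div (p := p) (n := n) (k := p)
    rw [Nat.mod_self, Nat.div_self (by omega), Nat.choose_zero_right, Nat.choose_one_right] at this
    simpa using this.symm.dvd
  · intro h
    by_contra hnp
    obtain ⟨q, hq, k, hk⟩ := Nat.exists_prime_and_dvd (n := p) (by omega)
    have hqp : q < p := by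
      rcases (Nat.le_of_dvd (by omega) ⟨k, hk⟩).lt_or_eq with h1 | h1
      · exact h1
      · exact absurd (h1 ▸ hq) hnp
    have h1 := h (p + q)
    have hd : (p + q) / p = 1 := by
      rw [Nat.add_div_left _ (by omega), Nat.div_eq_of_lt hqp]
    rw [hd, Nat.choose_symm_add] at h1
    have hC : (p + q).choose q ≡ 1 [MOD p] := by
      apply Nat.ModEq.symm
      rw [Nat.modEq_iff_dvd]
      exact_mod_cast h1
    obtain ⟨r, rfl⟩ : ∃ r, q = r + 1 := ⟨q - 1, by have := hq.pos; omega⟩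
    have h2 := Nat.ascFactorial_eq_factorial_mul_choose p (r + 1)
    rw [Nat.ascFactorial_succ, Nat.factorial_succ] at h2
    have h3 : (k + 1) * (p + 1).ascFactorial r = r.factorial * (p + (r + 1)).choose (r + 1) := by
      apply Nat.eq_of_mul_eq_mul_left (Nat.succ_pos r)
      have e : p + 1 + r = (r + 1) * (k + 1) := by rw [hk]; ring
      rw [e] at h2
      simp only [Nat.succ_eq_add_one]
      linarith
    have h4 : (k + 1) * r.factorial ≡ r.factorial * 1 [MOD p] :=
      ((asc_modEq_aux p r).symm.mul_left _).trans (h3 ▸ hC.mul_left _)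
    have h5 : p ∣ k * r.factorial := by
      have := (Nat.modEq_iff_dvd.1 h4.symm)
      push_cast at this
      have e : ((k : ℤ) + 1) * r.factorial - r.factorial * 1 = ((k * r.factorial : ℕ) : ℤ) := by
        push_cast; ring
      rw [e] at this
      exact_mod_cast this
    have hk0 : 0 < k := by
      rcases Nat.eq_zero_or_pos k with h | h
      · subst h; omega
      · exact h
    rw [hk, mul_comm] at h5
    have h6 := Nat.dvd_of_mul_dvd_mul_left hk0 h5
    have := (hq.dvd_factorial).1 h6
    omega
end

section
/- Let p > 1 be a composite natural number and let q be a prime divisor of p. Then C(p+q, p) is not congruent to ⌊(p+q)/p⌋ modulo p. -/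
theorem choose_not_modEq_floor_div_of_composite
    (p : ℕ) (hp : 1 < p) (hnp : ¬ p.Prime)
    (q : ℕ) (hq : q.Prime) (hqp : q ∣ p) :
    ¬ (((p + q).choose p : ℤ) ≡ (((p + q) / p : ℕ) : ℤ) [ZMOD (p : ℤ)]) := by
  intro h
  rw [Int.natCast_modEq_iff] at h
  have hlt : q < p := lt_of_le_of_ne (Nat.le_of_dvd (by omega) hqp) (fun e => hnp (e ▸ hq))
  have hd : (p + q) / p = 1 := by
    rw [Nat.add_div_left _ (by omega), Nat.div_eq_of_lt hlt]
  rw [hd, Nat.choose_symm_add] at h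
  obtain ⟨k, hk⟩ := hqp
  obtain ⟨r, rfl⟩ : ∃ r, q = r + 1 := ⟨q - 1, by have := hq.pos; omega⟩
  have hC : (p + (r + 1)).choose (r + 1) = (k + 1) * (p + r).choose r := by
    have h1 := Nat.add_one_mul_choose_eq (p + r) r
    apply Nat.eq_of_mul_eq_mul_right (Nat.succ_pos r)
    rw [← add_assoc, Nat.succ_eq_add_one, ← h1]
    have : p + r + 1 = (r + 1) * (k + 1) := by rw [hk]; ring
    rw [this]; ring
  have hA := asc_modEq_aux p r
  rw [Nat.ascFactorial_eq_factorial_mul_choose] at hA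
  rw [hC] at h
  have h2 := h.mul_left r.factorial
  have h3 := hA.mul_left (k + 1)
  have h4 : (k + 1) * r.factorial ≡ r.factorial [MOD p] := by
    refine h3.symm.trans ?_
    have e : (k + 1) * (r.factorial * (p + r).choose r)
      = r.factorial * ((k + 1) * (p + r).choose r) := by ring
    rw [e]; simpa using h2
  have h5 : p ∣ k * r.factorial := by
    have := (Nat.modEq_iff_dvd' (by nlinarith [r.factorial_pos])).1 h4.symm
    rwa [Nat.add_mul, one_mul, Nat.add_sub_cancel] at this
  have hk0 : 0 < k := by
    rcases Nat.eq_zero_or_pos k with h0 | h0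
    · subst h0; omega
    · exact h0
  rw [hk, mul_comm (r + 1) k] at h5
  have h6 := Nat.dvd_of_mul_dvd_mul_left hk0 h5
  have := (hq.dvd_factorial).1 h6
  omega
end

section
/- Let q be a prime, x ≥ 1 and k ≥ 1 natural numbers with gcd(q,k) = 1 and (x,k) ≠ (1,1), and set p = q^x · k. Then C(p+q, p) ≡ q^{x−1}·k + 1 (mod q^x). -/
theorem ascFactorial_modEq_aux (n p j : ℕ) (h : n ∣ p) :
    (p + 1).ascFactorial j ≡ j.factorial [MOD n] := by
  induction j with
  | zero => simp [Nat.ModEq]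
  | succ j ih =>
    rw [Nat.ascFactorial_succ, Nat.factorial_succ]
    refine Nat.ModEq.mul ?_ ih
    have h0 : p ≡ 0 [MOD n] := (Nat.modEq_zero_iff_dvd).2 h
    have h1 := h0.add_right (j + 1)
    have e : p + 1 + j = p + (j + 1) := by ring
    rw [e]
    simpa using h1

theorem choose_add_prime_modEq
    (q x k : ℕ) (hq : q.Prime) (hx : 1 ≤ x) (hk : 1 ≤ k)
    (hgcd : Nat.gcd q k = 1) (hne : ¬ (x = 1 ∧ k = 1))
    (p : ℕ) (hp : p = q ^ x * k) :
    (((p + q).choose p : ℤ)) ≡ ((q ^ (x - 1) * k + 1 : ℕ) : ℤ) [ZMOD ((q : ℤ) ^ x)] := by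
  have key : (p + q).choose p ≡ q ^ (x - 1) * k + 1 [MOD q ^ x] := by
    obtain ⟨y, rfl⟩ : ∃ y, x = y + 1 := ⟨x - 1, by omega⟩
    obtain ⟨r, rfl⟩ : ∃ r, q = r + 1 := ⟨q - 1, by have := hq.pos; omega⟩
    have h1 := Nat.ascFactorial_eq_factorial_mul_choose p (r + 1)
    rw [Nat.ascFactorial_succ, Nat.factorial_succ] at h1
    have h2 := ascFactorial_modEq_aux ((r + 1) ^ (y + 1)) p r ⟨k, hp⟩
    have h3 : r.factorial * (p + (r + 1)).choose (r + 1)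
        = ((r + 1) ^ y * k + 1) * (p + 1).ascFactorial r := by
      apply Nat.eq_of_mul_eq_mul_left (Nat.succ_pos r)
      have e : p + 1 + r = (r + 1) * ((r + 1) ^ y * k + 1) := by rw [hp]; ring
      rw [e] at h1
      simp only [Nat.succ_eq_add_one]
      rw [← mul_assoc, ← mul_assoc, ← h1]
    rw [Nat.choose_symm_add]
    have hc : Nat.gcd ((r + 1) ^ (y + 1)) r.factorial = 1 :=
      Nat.Coprime.pow_left _ (hq.coprime_factorial_of_lt (Nat.lt_succ_self r))
    refine Nat.ModEq.cancel_left_of_coprime hc ?_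
    rw [h3, mul_comm r.factorial]
    simpa using h2.mul_left _
  have := (Int.natCast_modEq_iff).2 key
  simpa using this
end

section
/- For all natural numbers x ≥ 1 and m ≥ 1, the sequence a_n = C(n,x) mod m is periodic in n: there exists a positive natural number k such that C(n+k, x) ≡ C(n, x) (mod m) for every natural number n. -/
theorem choose_mod_periodic
    (x m : ℕ) (hx : 1 ≤ x) (hm : 1 ≤ m) :
    ∃ k : ℕ, 0 < k ∧ ∀ n : ℕ, (n + k).choose x ≡ n.choose x [MOD m] := by
  have hk : 0 < m * x.factorial := Nat.mul_pos hm x.factorial_pos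
  refine ⟨m * x.factorial, hk, fun n => ?_⟩
  have key : ∀ j, 0 < j → j ≤ x → m ∣ (m * x.factorial).choose j := by
    intro j hj hjx
    obtain ⟨t, ht⟩ := Nat.dvd_factorial hj hjx
    obtain ⟨K, hK⟩ := Nat.exists_eq_succ_of_ne_zero hk.ne'
    obtain ⟨i, rfl⟩ := Nat.exists_eq_succ_of_ne_zero hj.ne'
    have h := Nat.add_one_mul_choose_eq K i
    rw [← Nat.succ_eq_add_one K, ← hK, ht] at h
    rw [ht]
    refine ⟨t * K.choose i, ?_⟩
    apply Nat.eq_of_mul_eq_mul_right hj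
    simp only [Nat.succ_eq_add_one] at h ⊢
    rw [← h]
    ring
  rw [Nat.add_choose_eq]
  have hmem : (x, 0) ∈ Finset.HasAntidiagonal.antidiagonal x := by simp
  rw [← Finset.add_sum_erase _ _ hmem]
  simp only [Nat.choose_zero_right, mul_one]
  have hd : m ∣ ∑ p ∈ (Finset.HasAntidiagonal.antidiagonal x).erase (x, 0),
      n.choose p.1 * (m * x.factorial).choose p.2 := by
    apply Finset.dvd_sum
    rintro ⟨a, b⟩ hp
    simp only [Finset.mem_erase, Finset.HasAntidiagonal.mem_antidiagonal, ne_eq, Prod.mk.injEq] at hp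
    exact Dvd.dvd.mul_left (key b (by omega) (by omega)) _
  simpa using Nat.ModEq.add_left (n.choose x) ((Nat.modEq_zero_iff_dvd).2 hd)
end

section
/- If m > 1 is a composite natural number, then there exist infinitely many natural numbers n such that C(n,m) is not congruent to ⌊n/m⌋ modulo m. -/
theorem aux_mul {Q i : ℕ} (hQ : 0 < Q) (hi : 0 < i) :
    Q * (Q - 1).choose (i - 1) = Q.choose i * i := by
  obtain ⟨q, rfl⟩ : ∃ q, Q = q + 1 := ⟨Q - 1, by omega⟩
  obtain ⟨j, rfl⟩ : ∃ j, i = j + 1 := ⟨i - 1, by omega⟩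
  simpa using Nat.add_one_mul_choose_eq q j

theorem aux_period {m Q : ℕ} (n : ℕ) (hQ : m * m.factorial ∣ Q) :
    (Q + n).choose m ≡ n.choose m [MOD m] := by
  rw [Nat.add_choose_eq, Finset.Nat.sum_antidiagonal_eq_sum_range_succ_mk, Finset.sum_range_succ']
  simp only [Nat.choose_zero_right, one_mul, Nat.sub_zero]
  have h : m ∣ ∑ k ∈ Finset.range m, Q.choose (k + 1) * n.choose (m - (k + 1)) := by
    apply Finset.dvd_sum
    intro k hk
    rw [Finset.mem_range] at hk
    apply Dvd.dvd.mul_right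
    rcases Nat.eq_zero_or_pos Q with rfl | hQ0
    · simp
    have h1 := aux_mul hQ0 (Nat.succ_pos k)
    have h2 : m * (k + 1) ∣ Q :=
      (Nat.mul_dvd_mul_left m (Nat.dvd_factorial (Nat.succ_pos k) hk)).trans hQ
    have h3 : m * (k + 1) ∣ Q.choose (k + 1) * (k + 1) := h1 ▸ h2.mul_right _
    exact Nat.dvd_of_mul_dvd_mul_right (Nat.succ_pos k) h3
  simpa using (Nat.modEq_zero_iff_dvd.2 h).add_right (n.choose m)

theorem aux_main {m : ℕ} (hm : 1 < m) :
    ¬ ((m + m.minFac).choose m ≡ 1 [MOD m]) := by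
  have hp : m.minFac.Prime := Nat.minFac_prime (by omega)
  have hpm : m.minFac ∣ m := Nat.minFac_dvd m
  have hmin : ∀ k, 0 < k → k < m.minFac → Nat.Coprime m k := by
    intro k hk hlt
    apply Nat.Coprime.symm
    by_contra hc
    obtain ⟨q, hq, h1, h2⟩ := Nat.Prime.not_coprime_iff_dvd.1 hc
    have := Nat.minFac_le_of_dvd hq.two_le h2
    have := Nat.le_of_dvd hk h1
    omega
  generalize m.minFac = p at *
  have hp2 := hp.two_le
  have hsym : (m + p).choose m = (m + p).choose p := Nat.choose_symm_add
  rw [hsym, Nat.add_choose_eq, Finset.Nat.sum_antidiagonal_eq_sum_range_succ_mk,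
    Finset.sum_range_succ]
  obtain ⟨r, rfl⟩ : ∃ r, p = r + 1 := ⟨p - 1, by omega⟩
  rw [Finset.sum_range_succ']
  simp only [Nat.choose_zero_right, one_mul, Nat.sub_zero, Nat.choose_self, Nat.sub_self, mul_one]
  have h : m ∣ ∑ k ∈ Finset.range r, m.choose (k + 1) * (r + 1).choose (r + 1 - (k + 1)) := by
    apply Finset.dvd_sum
    intro k hk
    rw [Finset.mem_range] at hk
    apply Dvd.dvd.mul_right
    have h1 := aux_mul (Q := m) (by omega) (Nat.succ_pos k)
    exact (hmin (k + 1) (by omega) (by omega)).dvd_of_dvd_mul_right (h1 ▸ Nat.dvd_mul_right _ _)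
  intro hcon
  have h4 : m ∣ m.choose (r + 1) := by
    have h5 := ((Nat.modEq_zero_iff_dvd.2 h).add_right (1 + m.choose (r + 1))).symm.trans
      (by simpa [add_assoc] using hcon)
    rw [zero_add] at h5
    exact Nat.modEq_zero_iff_dvd.1 (Nat.ModEq.add_left_cancel' 1 (by simpa using h5))
  obtain ⟨c, hc⟩ := h4
  have h6 := aux_mul (Q := m) (by omega) (Nat.succ_pos r)
  simp only [Nat.succ_eq_add_one] at h6
  rw [hc, mul_assoc] at h6
  have h7 := Nat.eq_of_mul_eq_mul_left (by omega) h6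
  simp only [Nat.add_sub_cancel] at h7
  haveI := Fact.mk hp
  have h8 := Choose.choose_modEq_choose_mod_mul_choose_div_nat (n := m - 1) (k := r) (p := r + 1)
  obtain ⟨d, hd⟩ := hpm
  obtain ⟨e, rfl⟩ : ∃ e, d = e + 1 := ⟨d - 1, by
    rcases d with _ | d
    · simp at hd; omega
    · simp⟩
  have h9 : m - 1 = r + (r + 1) * e := by rw [hd, mul_add]; omega
  have h10 : (m - 1) % (r + 1) = r := by
    rw [h9, Nat.add_mul_mod_self_left, Nat.mod_eq_of_lt (by omega)]
  rw [h10, Nat.mod_eq_of_lt (show r < r + 1 by omega), Nat.div_eq_of_lt (show r < r + 1 by omega),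
    h7] at h8
  simp only [Nat.choose_self, Nat.choose_zero_right, mul_one] at h8
  have h11 : c * (r + 1) ≡ 0 [MOD (r + 1)] := Nat.modEq_zero_iff_dvd.2 (Nat.dvd_mul_left _ _)
  have h12 := Nat.modEq_zero_iff_dvd.1 (h8.symm.trans h11)
  have := Nat.le_of_dvd one_pos h12
  omega

theorem infinite_not_modEq_of_composite
    (m : ℕ) (hm : 1 < m) (hnp : ¬ m.Prime) :
    {n : ℕ | ¬ (n.choose m ≡ n / m [MOD m])}.Infinite := by
  have hlt : m.minFac < m := (Nat.not_prime_iff_minFac_lt hm).1 hnp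
  have hf := Nat.factorial_pos m
  apply Set.infinite_of_injective_forall_mem
    (f := fun t : ℕ => m * (m * m.factorial * t) + (m + m.minFac))
  · intro a b hab
    have h1 : m * (m * m.factorial * a) = m * (m * m.factorial * b) := Nat.add_right_cancel hab
    have h2 := Nat.eq_of_mul_eq_mul_left (by omega) h1
    exact Nat.eq_of_mul_eq_mul_left (by positivity) h2
  · intro t hcon
    apply aux_main hm
    have h1 := aux_period (m := m) (Q := m * (m * m.factorial * t)) (m + m.minFac)
      (Dvd.dvd.mul_left (Nat.dvd_mul_right _ _) _)
    have h2 : (m * (m * m.factorial * t) + (m + m.minFac)) / m = m * (m.factorial * t) + 1 := by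
      rw [Nat.mul_add_div (by omega), Nat.add_div_left _ (by omega), Nat.div_eq_of_lt hlt]
      ring
    rw [h2] at hcon
    refine h1.symm.trans (hcon.trans ?_)
    simp [Nat.ModEq]
end

section
/- Let m > 1 be a natural number and define l(m) = m · ∏_{p prime, p ∣ m} p^{⌊log_p m⌋}. Then l(m) is the minimal positive period of the sequence a_n = C(n,m) mod m; that is, C(n + l(m), m) ≡ C(n, m) (mod m) for every natural number n, and every positive natural number k such that C(n + k, m) ≡ C(n, m) (mod m) for all n is a multiple of l(m). -/
theorem aux_dvd (p b L l j : ℕ) (hp : p.Prime) (hj : 0 < j) (hjL : j < p ^ (L+1))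
    (hl : p ^ (b + L) ∣ l) : p ^ b ∣ l.choose j := by
  obtain ⟨v, u, hu, rfl⟩ := Nat.exists_eq_pow_mul_and_not_dvd hj.ne' p hp.ne_one
  have hu0 : 0 < u := Nat.pos_of_ne_zero (by rintro rfl; simp at hu)
  have hv : v ≤ L := by
    have : p ^ v < p ^ (L+1) := lt_of_le_of_lt (Nat.le_mul_of_pos_right _ hu0) hjL
    have := (Nat.pow_lt_pow_iff_right hp.one_lt).1 this
    omega
  rcases l with _ | l
  · rw [Nat.choose_eq_zero_of_lt hj]; exact dvd_zero _
  obtain ⟨i, hi⟩ : ∃ i, p ^ v * u = i + 1 := ⟨p ^ v * u - 1, by omega⟩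
  have h1 := Nat.add_one_mul_choose_eq l i
  rw [← hi] at h1
  have h2 : p ^ (b + v) ∣ ((l+1).choose (p^v*u) * p ^ v) * u := by
    rw [mul_assoc, ← h1]
    exact ((pow_dvd_pow p (by omega)).trans hl).mul_right _
  have hc : Nat.Coprime (p ^ (b+v)) u := Nat.Coprime.pow_left _ ((hp.coprime_iff_not_dvd).2 hu)
  have h3 := hc.dvd_of_dvd_mul_right h2
  rw [pow_add] at h3
  exact Nat.dvd_of_mul_dvd_mul_right (pow_pos hp.pos v) h3

theorem aux_per (p b L l m n : ℕ) (hp : p.Prime) (hm : m < p ^ (L+1))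
    (hl : p ^ (b + L) ∣ l) : (n + l).choose m ≡ n.choose m [MOD p ^ b] := by
  rw [Nat.add_choose_eq, Finset.Nat.sum_antidiagonal_eq_sum_range_succ
    (fun i j => n.choose i * l.choose j), Finset.sum_range_succ]
  have : p ^ b ∣ ∑ k ∈ Finset.range m, n.choose k * l.choose (m - k) := by
    refine Finset.dvd_sum fun k hk => Dvd.dvd.mul_left ?_ _
    have := Finset.mem_range.1 hk
    exact aux_dvd p b L l _ hp (by omega) (by omega) hl
  have h := (Nat.modEq_zero_iff_dvd.2 this).add_right (n.choose m)
  simpa using h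

theorem aux_down (M m k : ℕ) (h : ∀ n : ℕ, (n + k).choose m ≡ n.choose m [MOD M]) (i : ℕ) :
    i ≤ m → ∀ n : ℕ, (n + k).choose (m - i) ≡ n.choose (m - i) [MOD M] := by
  induction i with
  | zero => intro _; simpa using h
  | succ i ih =>
    intro hi n
    have ih := ih (by omega)
    obtain ⟨j, hj⟩ : ∃ j, m - i = j + 1 := ⟨m - i - 1, by omega⟩
    have hj' : m - (i+1) = j := by omega
    rw [hj] at ih
    rw [hj']
    have h1 := ih (n+1)
    rw [show n + 1 + k = (n + k) + 1 by omega, Nat.choose_succ_succ, Nat.choose_succ_succ] at h1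
    exact Nat.ModEq.add_right_cancel (ih n) h1

theorem aux_conv (p b L k : ℕ) (hp : p.Prime) (hb : 0 < b) (hk : 0 < k)
    (h : ∀ i ≤ L, p ^ b ∣ k.choose (p ^ i)) : p ^ (b + L) ∣ k := by
  have key : ∀ i, i ≤ L → p ^ i ∣ k → p ^ (b + i) ∣ k := by
    intro i hi hik
    have hc : ¬ p ∣ (k-1).choose (p ^ i - 1) := by
      rcases i with _ | i
      · simpa using hp.one_lt.ne'
      · have hle := Nat.le_of_dvd hk hik
        have hpos : 0 < p ^ (i+1) := pow_pos hp.pos _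
        have := aux_per p 1 i (k - p^(i+1)) (p^(i+1)-1) (p^(i+1)-1) hp (by omega)
          (by rw [add_comm 1 i]; exact Nat.dvd_sub hik dvd_rfl)
        rw [show p ^ (i+1) - 1 + (k - p^(i+1)) = k - 1 by omega, Nat.choose_self, pow_one] at this
        intro hd
        have h2 := this.symm.trans (Nat.modEq_zero_iff_dvd.2 hd)
        exact hp.one_lt.ne' (Nat.dvd_one.1 (Nat.modEq_zero_iff_dvd.1 h2))
    have h1 := Nat.add_one_mul_choose_eq (k-1) (p^i-1)
    have hpos : 0 < p ^ i := pow_pos hp.pos _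
    rw [show k - 1 + 1 = k by omega, show p^i - 1 + 1 = p^i by omega] at h1
    have h2 : p ^ (b+i) ∣ k * (k-1).choose (p^i-1) := by
      rw [h1, pow_add]; exact Nat.mul_dvd_mul_right (h i hi) _
    exact (Nat.Coprime.pow_left _ ((hp.coprime_iff_not_dvd).2 hc)).dvd_of_dvd_mul_right h2
  have all : ∀ i, i ≤ L → p ^ i ∣ k := by
    intro i
    induction i with
    | zero => simp
    | succ i ih =>
      intro hi
      exact (pow_dvd_pow p (by omega)).trans (key i (by omega) (ih (by omega)))
  exact key L le_rfl (all L le_rfl)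

theorem aux_prod (s : Finset ℕ) (hs : ∀ p ∈ s, p.Prime) (f : ℕ → ℕ) (N : ℕ)
    (h : ∀ p ∈ s, p ^ f p ∣ N) : ∏ p ∈ s, p ^ f p ∣ N := by
  refine Finset.prod_dvd_of_isRelPrime ?_ h
  intro p hp q hq hpq
  exact Nat.coprime_iff_isRelPrime.1 (Nat.Coprime.pow _ _ ((Nat.coprime_primes (hs p hp) (hs q hq)).2 hpq))

theorem minimal_period_choose_mod
    (m : ℕ) (hm : 1 < m)
    (l : ℕ) (hl : l = m * ∏ p ∈ m.primeFactors, p ^ Nat.log p m) :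
    (∀ n : ℕ, (n + l).choose m ≡ n.choose m [MOD m]) ∧
    (∀ k : ℕ, 0 < k → (∀ n : ℕ, (n + k).choose m ≡ n.choose m [MOD m]) → l ∣ k) := by
  have hmp : m = ∏ p ∈ m.primeFactors, p ^ m.factorization p :=
    (Nat.prod_factorization_pow_eq_self (by omega : m ≠ 0)).symm
  have hl2 : l = ∏ p ∈ m.primeFactors, p ^ (m.factorization p + Nat.log p m) := by
    rw [hl]
    simp only [pow_add]
    rw [Finset.prod_mul_distrib, ← hmp]
  have hpr : ∀ p ∈ m.primeFactors, p.Prime := fun p hp => Nat.prime_of_mem_primeFactors hp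
  constructor
  · intro n
    refine Nat.ModEq.symm ((Nat.modEq_iff_dvd' (Nat.choose_le_choose m (by omega))).2 ?_)
    have := aux_prod m.primeFactors hpr (fun p => m.factorization p)
      ((n+l).choose m - n.choose m) ?_
    · rwa [← hmp] at this
    · intro p hp
      refine (Nat.modEq_iff_dvd' (Nat.choose_le_choose m (by omega))).1 (Nat.ModEq.symm ?_)
      refine aux_per p _ (Nat.log p m) l m n (hpr p hp)
        (Nat.lt_pow_succ_log_self (hpr p hp).one_lt m) ?_
      rw [hl2]
      exact Finset.dvd_prod_of_mem (fun p => p ^ (m.factorization p + Nat.log p m)) hp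
  · intro k hk h
    rw [hl2]
    refine aux_prod _ hpr (fun p => m.factorization p + Nat.log p m) k ?_
    intro p hp
    refine aux_conv p _ _ k (hpr p hp) ((hpr p hp).factorization_pos_of_dvd (by omega)
      (Nat.dvd_of_mem_primeFactors hp)) hk ?_
    intro i hi
    have hle : p ^ i ≤ m := (Nat.pow_le_pow_right (hpr p hp).pos hi).trans
      (Nat.pow_log_le_self p (by omega))
    have := aux_down m m k h (m - p ^ i) (by omega) 0
    rw [show m - (m - p^i) = p ^ i by omega, zero_add,
      Nat.choose_eq_zero_of_lt (pow_pos (hpr p hp).pos i)] at this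
    exact (Nat.ordProj_dvd m p).trans (Nat.modEq_zero_iff_dvd.1 this)
end

section
/- Let m > 1 be a natural number and define l(m) = m · ∏_{p prime, p ∣ m} p^{⌊log_p m⌋}. Then C(n + l(m), m) ≡ C(n, m) (mod m) for every natural number n. -/
theorem m_dvd_choose_aux
    (m : ℕ) (hm : 1 < m)
    (l : ℕ) (hl : l = m * ∏ p ∈ m.primeFactors, p ^ Nat.log p m)
    (j : ℕ) (hj : 0 < j) (hjm : j ≤ m) : m ∣ l.choose j := by
  have hdvd : l ∣ j * l.choose j := by
    obtain ⟨i, rfl⟩ : ∃ i, j = i + 1 := ⟨j - 1, by omega⟩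
    rcases l with _ | l
    · simp
    · exact ⟨l.choose i, by rw [mul_comm, ← Nat.add_one_mul_choose_eq]⟩
  rw [Nat.dvd_iff_prime_pow_dvd_dvd]
  intro p k hp hk
  rcases Nat.eq_zero_or_pos k with rfl | hk0
  · simp
  have hpm : p ∈ m.primeFactors :=
    Nat.mem_primeFactors.2 ⟨hp, (dvd_pow_self p hk0.ne').trans hk, by omega⟩
  have h1 : p ^ k * p ^ Nat.log p m ∣ j * l.choose j := by
    refine dvd_trans ?_ hdvd
    rw [hl]
    exact mul_dvd_mul hk (Finset.dvd_prod_of_mem (fun p => p ^ Nat.log p m) hpm)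
  obtain ⟨a, u, hu, hju⟩ := Nat.exists_eq_pow_mul_and_not_dvd hj.ne' p hp.ne_one
  have hpa : p ^ a ≤ m := (Nat.le_of_dvd hj ⟨u, hju⟩).trans hjm
  have ha : a ≤ Nat.log p m := Nat.le_log_of_pow_le hp.one_lt hpa
  have h2 : p ^ a * p ^ k ∣ p ^ a * (u * l.choose j) := by
    rw [← mul_assoc, ← hju, mul_comm]
    exact (mul_dvd_mul_left _ (pow_dvd_pow p ha)).trans h1
  have h3 := Nat.dvd_of_mul_dvd_mul_left (pow_pos hp.pos a) h2
  exact (Nat.Coprime.pow_left k ((Nat.Prime.coprime_iff_not_dvd hp).2 hu)).dvd_of_dvd_mul_left h3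

theorem choose_add_l_modEq
    (m : ℕ) (hm : 1 < m)
    (l : ℕ) (hl : l = m * ∏ p ∈ m.primeFactors, p ^ Nat.log p m)
    (n : ℕ) :
    (n + l).choose m ≡ n.choose m [MOD m] := by
  rw [Nat.add_choose_eq, Finset.Nat.sum_antidiagonal_eq_sum_range_succ_mk,
    Finset.sum_range_succ]
  simp only [Nat.sub_self, Nat.choose_zero_right, mul_one]
  have h : m ∣ ∑ k ∈ Finset.range m, n.choose k * l.choose (m - k) := by
    refine Finset.dvd_sum fun k hk => ?_
    have := Finset.mem_range.1 hk
    exact Dvd.dvd.mul_left (m_dvd_choose_aux m hm l hl (m - k) (by omega) (by omega)) _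
  simpa using (Nat.modEq_zero_iff_dvd.2 h).add_right (n.choose m)
end

section
/- Let m > 1 be a natural number, define l(m) = m · ∏_{p prime, p ∣ m} p^{⌊log_p m⌋}, and let k be a positive natural number such that C(n + k, m) ≡ C(n, m) (mod m) for every natural number n. Then l(m) divides k. -/
theorem aux_choose_period (m k M : ℕ)
    (hper : ∀ n : ℕ, (n + k).choose m ≡ n.choose m [MOD M]) :
    ∀ d j, j + d = m → ∀ n : ℕ, (n + k).choose j ≡ n.choose j [MOD M] := by
  intro d
  induction d with
  | zero => intro j hj n; simp at hj; subst hj; exact hper n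
  | succ d ih =>
    intro j hj n
    have h1 := ih (j + 1) (by omega) (n + 1)
    have h2 := ih (j + 1) (by omega) n
    rw [show n + 1 + k = (n + k) + 1 by ring, Nat.choose_succ_succ, Nat.choose_succ_succ n j] at h1
    exact Nat.ModEq.add_right_cancel h2 h1

theorem aux_lucas (p : ℕ) (hp : p.Prime) :
    ∀ j v, 0 < v → ¬ p ∣ (p ^ j * v - 1).choose (p ^ j - 1) := by
  intro j
  haveI : Fact p.Prime := ⟨hp⟩
  have key : ∀ w, 0 < w → (p * w - 1) % p = p - 1 ∧ (p * w - 1) / p = w - 1 := by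
    intro w hw
    obtain ⟨w, rfl⟩ : ∃ x, w = x + 1 := ⟨w - 1, by omega⟩
    have h : p * (w + 1) - 1 = (p - 1) + p * w := by
      have := hp.pos
      rw [mul_add]; omega
    have hlt : p - 1 < p := by have := hp.pos; omega
    rw [h]
    constructor
    · rw [Nat.add_mul_mod_self_left, Nat.mod_eq_of_lt hlt]
    · rw [Nat.add_mul_div_left _ _ hp.pos, Nat.div_eq_of_lt hlt]; simp
  induction j with
  | zero => intro v hv; simpa using hp.one_lt.ne'
  | succ j ih =>
    intro v hv h
    have hpj : 0 < p ^ j := pow_pos hp.pos _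
    have := @Choose.choose_modEq_choose_mod_mul_choose_div_nat (p ^ (j + 1) * v - 1) (p ^ (j + 1) - 1) p _
    rw [show p ^ (j + 1) * v = p * (p ^ j * v) by ring, show p ^ (j + 1) = p * p ^ j by ring,
      (key _ (Nat.mul_pos hpj hv)).1, (key _ (Nat.mul_pos hpj hv)).2, (key _ hpj).1, (key _ hpj).2,
      Nat.choose_self, one_mul] at this
    rw [show p ^ (j + 1) * v = p * (p ^ j * v) by ring, show p ^ (j + 1) = p * p ^ j by ring] at h
    exact ih v hv ((this.dvd_iff dvd_rfl).1 h)

theorem aux_prime (p e s k : ℕ) (hp : p.Prime) (he : 0 < e) (hk : 0 < k)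
    (h : ∀ j, 0 < j → j ≤ p ^ s → p ^ e ∣ k.choose j) :
    ∀ j, j ≤ s → p ^ (e + j) ∣ k := by
  have step : ∀ j, j ≤ s → p ^ j ∣ k → p ^ (e + j) ∣ k := by
    intro j hj hd
    obtain ⟨v, rfl⟩ := hd
    have hpj : 0 < p ^ j := pow_pos hp.pos _
    have hv : 0 < v := Nat.pos_of_mul_pos_left hk
    have h1 := h (p ^ j) hpj (Nat.pow_le_pow_right hp.pos hj)
    have h2 := Nat.add_one_mul_choose_eq (p ^ j * v - 1) (p ^ j - 1)
    rw [Nat.sub_add_cancel hk, Nat.sub_add_cancel hpj] at h2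
    have h3 : p ^ (e + j) ∣ p ^ j * v * (p ^ j * v - 1).choose (p ^ j - 1) := by
      rw [h2, pow_add]; exact Nat.mul_dvd_mul_right h1 _
    refine Nat.Coprime.dvd_of_dvd_mul_right ?_ h3
    exact Nat.Coprime.pow_left _ ((hp.coprime_iff_not_dvd).2 (aux_lucas p hp j v hv))
  intro j
  induction j with
  | zero => intro hj; exact step 0 hj (by simp)
  | succ j ih =>
    intro hj
    exact step _ hj ((pow_dvd_pow p (by omega)).trans (ih (by omega)))

theorem l_dvd_period
    (m : ℕ) (hm : 1 < m)
    (l : ℕ) (hl : l = m * ∏ p ∈ m.primeFactors, p ^ Nat.log p m)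
    (k : ℕ) (hk : 0 < k)
    (hper : ∀ n : ℕ, (n + k).choose m ≡ n.choose m [MOD m]) :
    l ∣ k := by
  have hm0 : m ≠ 0 := by omega
  have h0 : ∀ j, 0 < j → j ≤ m → m ∣ k.choose j := by
    intro j hj hjm
    have := aux_choose_period m k m hper (m - j) j (by omega) 0
    rw [zero_add, Nat.choose_eq_zero_of_lt hj] at this
    exact (Nat.modEq_zero_iff_dvd).1 this
  have hl2 : l = ∏ p ∈ m.primeFactors, p ^ (m.factorization p + Nat.log p m) := by
    rw [hl]
    simp only [pow_add, Finset.prod_mul_distrib]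
    congr 1
    exact (Nat.prod_factorization_pow_eq_self hm0).symm
  rw [hl2]
  apply Finset.prod_dvd_of_isRelPrime
  · intro p hp q hq hpq
    have hp' := Nat.prime_of_mem_primeFactors hp
    have hq' := Nat.prime_of_mem_primeFactors hq
    exact Nat.coprime_iff_isRelPrime.1 (Nat.Coprime.pow _ _ ((Nat.coprime_primes hp' hq').2 hpq))
  · intro p hp
    have hp' := Nat.prime_of_mem_primeFactors hp
    refine aux_prime p _ (Nat.log p m) k hp'
      (hp'.factorization_pos_of_dvd hm0 (Nat.dvd_of_mem_primeFactors hp)) hk ?_ _ le_rfl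
    intro j hj hjs
    exact (Nat.ordProj_dvd m p).trans (h0 j hj (hjs.trans (Nat.pow_log_le_self p hm0)))
end

section
/- Let m > 1 be a natural number and l(m) = m · ∏_{p prime, p ∣ m} p^{⌊log_p m⌋}. Then l(m) = m² if and only if m is a prime power, i.e., m = p^b for some prime p and natural number b ≥ 1. -/
theorem l_eq_sq_iff_prime_pow
    (m : ℕ) (hm : 1 < m)
    (l : ℕ) (hl : l = m * ∏ p ∈ m.primeFactors, p ^ Nat.log p m) :
    l = m ^ 2 ↔ ∃ p b : ℕ, p.Prime ∧ 1 ≤ b ∧ m = p ^ b := by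
  subst hl
  constructor
  · intro h
    have h1 : ∏ p ∈ m.primeFactors, p ^ Nat.log p m = m := by
      apply Nat.eq_of_mul_eq_mul_left (show 0 < m by omega)
      rw [h, sq]
    have hp : m.minFac.Prime := Nat.minFac_prime (by omega)
    have hle : m.minFac ≤ m := Nat.minFac_le (by omega)
    have hmem : m.minFac ∈ m.primeFactors :=
      Nat.mem_primeFactors.2 ⟨hp, Nat.minFac_dvd m, by omega⟩
    have hd : m.minFac ^ Nat.log m.minFac m ∣ m := by
      have := Finset.dvd_prod_of_mem (fun p => p ^ Nat.log p m) hmem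
      rwa [h1] at this
    refine ⟨m.minFac, Nat.log m.minFac m, hp, Nat.log_pos hp.one_lt hle, ?_⟩
    obtain ⟨k, hk⟩ := hd
    have hlt := Nat.lt_pow_succ_log_self hp.one_lt m
    generalize Nat.log m.minFac m = e at *
    have hkm : k ∣ m := ⟨_, hk.trans (mul_comm _ _)⟩
    have hk0 : 0 < k := Nat.pos_of_dvd_of_pos hkm (by omega)
    by_cases hk1 : k = 1
    · rw [hk1, mul_one] at hk
      exact hk
    · exfalso
      have h2 : m.minFac ≤ k := Nat.minFac_le_of_dvd (by omega) hkm
      have h3 := Nat.mul_le_mul_left (m.minFac ^ e) h2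
      rw [← hk, ← pow_succ] at h3
      exact absurd hlt (not_lt.2 h3)
  · rintro ⟨p, b, hp, hb, rfl⟩
    rw [Nat.primeFactors_prime_pow (by omega) hp, Finset.prod_singleton,
      Nat.log_pow hp.one_lt, sq]
end

section
/- A natural number p > 1 is prime if and only if for every prime number q, p divides C(q,p) − ⌊q/p⌋. -/
theorem aux_floor (q w n d : ℕ) (h : q ≡ w [MOD n * d]) : q / n ≡ w / n [MOD d] := by
  unfold Nat.ModEq at *
  rw [← Nat.mod_mul_right_div_self, ← Nat.mod_mul_right_div_self, h]

theorem aux_desc (q y M n : ℕ) (h : q ≡ y [MOD M]) :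
    q.descFactorial n ≡ y.descFactorial n [MOD M] := by
  have h1 := (Int.natCast_modEq_iff.mpr h).dvd
  have h2 := (descPochhammer ℤ n).sub_dvd_eval_sub (y : ℤ) (q : ℤ)
  rw [descPochhammer_eval_eq_descFactorial, descPochhammer_eval_eq_descFactorial] at h2
  exact Int.natCast_modEq_iff.mp (Int.modEq_iff_dvd.mpr (h1.trans h2))

theorem aux_choose (r n e : ℕ) (hr : r.Prime) :
    ∃ N, ∀ q y : ℕ, q ≡ y [MOD r ^ N] → q.choose n ≡ y.choose n [MOD r ^ e] := by
  obtain ⟨v, u, hu, hf⟩ := Nat.exists_eq_pow_mul_and_not_dvd (Nat.factorial_ne_zero n) r hr.ne_one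
  refine ⟨v + e, fun q y h => ?_⟩
  have h1 := aux_desc q y _ n h
  rw [Nat.descFactorial_eq_factorial_mul_choose, Nat.descFactorial_eq_factorial_mul_choose, hf,
    pow_add, mul_assoc, mul_assoc] at h1
  have h2 := Nat.ModEq.mul_left_cancel' (pow_ne_zero v hr.ne_zero) h1
  exact Nat.ModEq.cancel_left_of_coprime
    (((Nat.Prime.coprime_iff_not_dvd hr).mpr hu).pow_left e) h2

theorem aux_key (n r a m e w y : ℕ) (hr : r.Prime) (hn : n = r ^ a * m) (hm : m ≠ 0)
    (ha : a ≠ 0)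
    (hc : Nat.Coprime r m) (he : e ≤ a) (hw : w.Coprime n) (hwy : w ≡ y [MOD r ^ (a + e)])
    (H : ∀ q : ℕ, q.Prime → (n : ℤ) ∣ (q.choose n : ℤ) - (q / n : ℕ)) :
    y.choose n ≡ w / n [MOD r ^ e] := by
  obtain ⟨N, hN⟩ := aux_choose r n e hr
  have hcop : Nat.Coprime (r ^ (N + (a + e))) m := hc.pow_left _
  obtain ⟨x, hx1, hx2⟩ := Nat.chineseRemainder hcop y w
  have hwr : w.Coprime r := by
    apply Nat.Coprime.coprime_dvd_right _ hw
    rw [hn]; exact Dvd.dvd.mul_right (dvd_pow_self r ha) m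
  have hwm : w.Coprime m := by
    apply Nat.Coprime.coprime_dvd_right _ hw
    rw [hn]; exact Dvd.intro_left _ rfl
  have hxw : x ≡ w [MOD r ^ (a + e)] :=
    (hx1.of_dvd (pow_dvd_pow r (Nat.le_add_left _ _))).trans hwy.symm
  have hxr : x.Coprime r := by
    have := (hxw.of_dvd (dvd_pow_self r (by omega))).gcd_eq
    unfold Nat.Coprime at *
    rw [this, hwr]
  have hxm : x.Coprime m := by
    have := hx2.gcd_eq
    unfold Nat.Coprime at *
    rw [this, hwm]
  obtain ⟨q, -, hq, hqx⟩ := Nat.forall_exists_prime_gt_and_modEq 0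
    (q := r ^ (N + (a + e)) * m) (a := x) (mul_ne_zero (pow_ne_zero _ hr.ne_zero) hm)
    (Nat.Coprime.mul_right (hxr.pow_right _) hxm)
  have hq1 : q ≡ y [MOD r ^ (N + (a + e))] := (hqx.of_dvd (Dvd.intro _ rfl)).trans hx1
  have hq2 : q ≡ w [MOD m] := (hqx.of_dvd (Dvd.intro_left _ rfl)).trans hx2
  have hq3 : q ≡ w [MOD r ^ (a + e)] :=
    (hq1.of_dvd (pow_dvd_pow r (Nat.le_add_left _ _))).trans hwy.symm
  have hq4 : q ≡ w [MOD n * r ^ e] := by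
    have := (Nat.modEq_and_modEq_iff_modEq_mul (hc.pow_left (a + e))).mp ⟨hq3, hq2⟩
    have e1 : n * r ^ e = r ^ (a + e) * m := by rw [hn]; ring
    rwa [e1]
  have h1 := aux_floor _ _ _ _ hq4
  have h2 := hN q y (hq1.of_dvd (pow_dvd_pow r (Nat.le_add_right _ _)))
  have h3 : q / n ≡ q.choose n [MOD n] :=
    Int.natCast_modEq_iff.mp (Int.modEq_iff_dvd.mpr (H q hq))
  have h4 : q / n ≡ q.choose n [MOD r ^ e] := h3.of_dvd (by
    rw [hn]; exact Dvd.dvd.mul_right (pow_dvd_pow r he) m)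
  exact h2.symm.trans (h4.symm.trans h1)

theorem aux_case1 (n r a m : ℕ) (hr : r.Prime) (hn : n = r ^ a * m) (ha : a ≠ 0)
    (hc : Nat.Coprime r m) (hrm : r ≤ m)
    (H : ∀ q : ℕ, q.Prime → (n : ℤ) ∣ (q.choose n : ℤ) - (q / n : ℕ)) : False := by
  have hr2 := hr.two_le
  have hra : 0 < r ^ (a + 1) := pow_pos hr.pos _
  have hle : r ^ (a + 1) ≤ n := by rw [hn, pow_succ]; exact Nat.mul_le_mul_left _ hrm
  have hn1 : 1 < n := lt_of_lt_of_le (Nat.one_lt_pow (by omega) hr.one_lt) hle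
  have h := aux_key n r a m 1 (1 + n) ((1 + n) % r ^ (a + 1)) hr hn (by omega) ha hc (by omega)
    (by simp) (Nat.mod_modEq _ _).symm H
  rw [Nat.choose_eq_zero_of_lt (lt_of_lt_of_le (Nat.mod_lt _ hra) hle),
    Nat.add_div_right _ (by omega), Nat.div_eq_of_lt hn1, pow_one] at h
  have := (Nat.modEq_zero_iff_dvd.mp h.symm)
  have := Nat.le_of_dvd (by norm_num) this
  omega

theorem aux_case2 (n r a : ℕ) (hr : r.Prime) (hn : n = r ^ a) (ha : 2 ≤ a)
    (H : ∀ q : ℕ, q.Prime → (n : ℤ) ∣ (q.choose n : ℤ) - (q / n : ℕ)) : False := by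
  obtain ⟨b, rfl⟩ : ∃ b, a = b + 2 := ⟨a - 2, by omega⟩
  have hr2 := hr.two_le
  obtain ⟨s, hs⟩ : ∃ s, r ^ (b + 1) = s + 1 :=
    ⟨r ^ (b + 1) - 1, by have := pow_pos hr.pos (b + 1); omega⟩
  have hrs : r ∣ s + 1 := hs ▸ dvd_pow_self r (by omega)
  have hs1 : 2 ≤ s + 1 := hr2.trans (Nat.le_of_dvd (by omega) hrs)
  have hnr : n = r * (s + 1) := by rw [hn, ← hs]; ring
  have hrn : r ∣ n := ⟨_, hnr⟩
  have hn2 : 2 * (s + 1) ≤ n := by rw [hnr]; exact Nat.mul_le_mul_right _ hr2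
  have key : ∀ i, i < n → ¬ r ∣ i → (i + n).choose n ≡ 1 [MOD r ^ 2] := by
    intro i hi hri
    have h := aux_key n r (b + 2) 1 2 (i + n) (i + n) hr (by simpa using hn) (by omega) (by omega)
      (by simp) (by omega) (by
        rw [hn]
        apply Nat.Coprime.pow_right
        rw [Nat.coprime_comm, Nat.Prime.coprime_iff_not_dvd hr, ← hn]
        rwa [← Nat.dvd_add_iff_left hrn]) rfl H
    rwa [Nat.add_div_right _ (by omega), Nat.div_eq_of_lt hi] at h
  have n1 : ¬ r ∣ 1 := fun h => by have := Nat.le_of_dvd (by omega) h; omega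
  have k1 := key s (by omega) (fun h => n1 ((Nat.dvd_add_iff_right h).mpr hrs))
  have k3 := key (s + 2) (by omega) (fun h => n1 ((Nat.dvd_add_iff_right hrs).mpr h))
  have e1 := Nat.choose_mul_succ_eq (s + n) n
  have e2 := Nat.choose_mul_succ_eq (s + 1 + n) n
  rw [show s + n + 1 - n = s + 1 by omega, show s + n + 1 = s + 1 + n by ring] at e1
  rw [show s + 1 + n + 1 - n = s + 2 by omega, show s + 1 + n + 1 = s + 2 + n by ring] at e2
  generalize (s + n).choose n = A at *
  generalize (s + 1 + n).choose n = B at *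
  generalize (s + 2 + n).choose n = C at *
  have e3 : B = A * (r + 1) := by
    apply Nat.eq_of_mul_eq_mul_right (Nat.succ_pos s)
    rw [Nat.succ_eq_add_one, ← e1, hnr]; ring
  have hn0 : n ≡ 0 [MOD r ^ 2] := by
    rw [Nat.modEq_zero_iff_dvd, hn]; exact pow_dvd_pow r (by omega)
  have f : B * (s + 2 + n) ≡ 1 * (r + 1) * (s + 2 + 0) [MOD r ^ 2] := by
    rw [e3]
    exact (k1.mul_right _).mul (hn0.add_left _)
  rw [e2] at f
  have g := (k3.mul_right (s + 2)).symm.trans f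
  have g2 : 0 + (s + 2) ≡ r * (s + 2) + (s + 2) [MOD r ^ 2] := by
    convert g using 1 <;> ring
  have g3 := (Nat.modEq_zero_iff_dvd.mp (Nat.ModEq.add_right_cancel' _ g2).symm)
  rw [pow_two] at g3
  have g4 := Nat.dvd_of_mul_dvd_mul_left hr.pos g3
  exact n1 ((Nat.dvd_add_iff_right hrs).mpr g4)

theorem prime_iff_forall_prime_choose_sub_floor_div
    (p : ℕ) (hp : 1 < p) :
    p.Prime ↔ ∀ q : ℕ, q.Prime → (p : ℤ) ∣ (q.choose p : ℤ) - (q / p : ℕ) := by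
  constructor
  · intro h q _
    haveI := Fact.mk h
    have := @Choose.choose_modEq_choose_mod_mul_choose_div q p p _
    rw [Nat.mod_self, Nat.choose_zero_right, Nat.div_self h.pos, Nat.choose_one_right] at this
    exact this.symm.dvd.trans (by simp)
  · intro H
    by_contra hnp
    have hr : p.minFac.Prime := Nat.minFac_prime (by omega)
    obtain ⟨a, m, hm, hf⟩ := Nat.exists_eq_pow_mul_and_not_dvd (n := p) (by omega) p.minFac hr.ne_one
    have hc := (Nat.Prime.coprime_iff_not_dvd hr).mpr hm
    have ha : a ≠ 0 := by
      rintro rfl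
      apply hm
      rw [pow_zero, one_mul] at hf
      rw [← hf]
      exact p.minFac_dvd
    have hm0 : m ≠ 0 := by rintro rfl; simp at hm
    by_cases hm1 : m = 1
    · subst hm1
      rw [mul_one] at hf
      refine aux_case2 p _ a hr hf ?_ H
      by_contra h
      have : a = 1 := by omega
      rw [this, pow_one] at hf
      exact hnp (hf ▸ hr)
    · exact aux_case1 p _ a m hr hf ha hc
        (Nat.minFac_le_of_dvd (by omega) (Dvd.intro_left _ hf.symm)) H
end

section
/- If p > 1 is a composite natural number, then there exists a prime number q such that C(q,p) is not congruent to ⌊q/p⌋ modulo p. -/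
theorem desc_neg_one_aux (n : ℕ) :
    (descPochhammer ℤ n).eval (-1) = (-1) ^ n * (n.factorial : ℤ) := by
  induction n with
  | zero => simp
  | succ k ih =>
    rw [descPochhammer_succ_right, Polynomial.eval_mul, ih]
    simp [Nat.factorial_succ, pow_succ]
    ring

theorem desc_nat_aux (n q : ℕ) :
    (descPochhammer ℤ n).eval (q : ℤ) = (n.factorial : ℤ) * (q.choose n : ℤ) := by
  rw [descPochhammer_eval_eq_descFactorial, Nat.descFactorial_eq_factorial_mul_choose]
  push_cast
  rfl

theorem even_case_aux (n : ℕ) (hn : 2 < n) (he : Even n) :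
    ∃ q : ℕ, q.Prime ∧
      ¬ ((q.choose n : ℤ) ≡ ((q / n : ℕ) : ℤ) [ZMOD (n : ℤ)]) := by
  set M := n.factorial * (n * n) with hM
  have hM0 : M ≠ 0 := by positivity
  obtain ⟨q, -, hq, hqm⟩ := Nat.forall_exists_prime_gt_and_zmodEq 0 (q := M) (a := -1) hM0
    isCoprime_one_left.neg_left
  refine ⟨q, hq, fun h => ?_⟩
  have h1 : (M : ℤ) ∣ (q : ℤ) - (-1) := hqm.symm.dvd
  have h2 := h1.trans (Polynomial.sub_dvd_eval_sub (q : ℤ) (-1) (descPochhammer ℤ n))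
  rw [desc_nat_aux, desc_neg_one_aux, he.neg_one_pow, one_mul] at h2
  have h3 : (n : ℤ) ∣ (q.choose n : ℤ) - 1 := by
    have : (n.factorial : ℤ) * (n * n) ∣ n.factorial * ((q.choose n : ℤ) - 1) := by
      rw [hM] at h2; push_cast at h2
      obtain ⟨y, hy⟩ := h2
      exact ⟨y, by linear_combination hy⟩
    exact (Dvd.intro _ rfl).trans ((mul_dvd_mul_iff_left (by positivity)).1 this)
  have h4 : (n : ℤ) ∣ ((q / n : ℕ) : ℤ) + 1 := by
    obtain ⟨t, ht⟩ := h1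
    have : (q : ℤ) / n = n.factorial * n * t - 1 := by
      have hn0 : (n : ℤ) > 0 := by positivity
      rw [Int.ediv_eq_iff_of_pos hn0]
      rw [hM] at ht; push_cast at ht
      constructor <;> nlinarith
    push_cast
    rw [this]
    exact ⟨n.factorial * t, by ring⟩
  have h5 := h.dvd
  have h6 : (n : ℤ) ∣ 2 := by
    have := dvd_sub h4 (dvd_add h5 h3)
    ring_nf at this
    exact this
  have := Int.le_of_dvd (by norm_num) h6
  omega

theorem odd_case_aux (n : ℕ) (hn : 1 < n) (hnp : ¬ n.Prime) (he : ¬ Even n) :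
    ∃ q : ℕ, q.Prime ∧
      ¬ ((q.choose n : ℤ) ≡ ((q / n : ℕ) : ℤ) [ZMOD (n : ℤ)]) := by
  obtain ⟨r, hr⟩ : ∃ r, r = n.minFac := ⟨_, rfl⟩
  have hrp : r.Prime := hr ▸ Nat.minFac_prime (by omega)
  have hrn : r ∣ n := hr ▸ Nat.minFac_dvd n
  have hr2 : r ≠ 2 := by
    rintro h; exact he (even_iff_two_dvd.2 (h ▸ hrn))
  have hr3 : 3 ≤ r := by have := hrp.two_le; omega
  have hsq : r ^ 2 ≤ n := hr ▸ Nat.minFac_sq_le_self (by omega) hnp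
  have hlt : r + 1 < n := by nlinarith
  have hcop : Nat.Coprime (n + r + 1) n := by
    refine Nat.Coprime.symm (Nat.coprime_of_dvd ?_)
    intro l hl hln hla
    have h1 : l ∣ r + 1 := by
      rw [add_assoc] at hla; exact (Nat.dvd_add_right hln).1 hla
    have h2 : r ≤ l := hr ▸ Nat.minFac_le_of_dvd hl.two_le hln
    have h3 := Nat.le_of_dvd (by omega) h1
    rcases (by omega : l = r ∨ l = r + 1) with h | h
    · subst h
      have := (Nat.dvd_add_right (dvd_refl l)).1 h1
      exact hl.one_lt.ne' (Nat.dvd_one.1 this)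
    · have hro := hrp.odd_of_ne_two hr2
      have : Even l := by rw [h]; exact hro.add_one
      exact he (even_iff_two_dvd.2 ((even_iff_two_dvd.1 this).trans hln))
  obtain ⟨e, B, hB, hfac⟩ := Nat.exists_eq_pow_mul_and_not_dvd
    (Nat.factorial_ne_zero n) r hrp.ne_one
  obtain ⟨n', hn'⟩ := hrn
  set M := r ^ e * (n * n) with hM
  have hrpos := hrp.pos
  have hM0 : M ≠ 0 := by positivity
  have hcM : Nat.Coprime (n + r + 1) M := by
    have : Nat.Coprime (n + r + 1) r := Nat.Coprime.coprime_dvd_right ⟨n', hn'⟩ hcop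
    exact Nat.Coprime.mul_right (this.pow_right e) (hcop.mul_right hcop)
  obtain ⟨q, -, hq, hqm⟩ := Nat.forall_exists_prime_gt_and_zmodEq 0 (q := M)
    (a := ((n + r + 1 : ℕ) : ℤ)) hM0 (Nat.isCoprime_iff_coprime.2 hcM)
  refine ⟨q, hq, fun h => ?_⟩
  have h1 : (M : ℤ) ∣ (q : ℤ) - ((n + r + 1 : ℕ) : ℤ) := hqm.symm.dvd
  have h2 := h1.trans (Polynomial.sub_dvd_eval_sub (q : ℤ) _ (descPochhammer ℤ n))
  rw [desc_nat_aux, desc_nat_aux, hfac] at h2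
  set C : ℤ := ((n + r + 1).choose n : ℤ) with hC
  have h3 : (n : ℤ) ∣ B * ((q.choose n : ℤ) - C) := by
    have : ((r : ℤ) ^ e) * (n * n) ∣ (r : ℤ) ^ e * (B * ((q.choose n : ℤ) - C)) := by
      rw [hM] at h2; push_cast at h2
      obtain ⟨y, hy⟩ := h2
      exact ⟨y, by linear_combination hy⟩
    exact (Dvd.intro _ rfl).trans ((mul_dvd_mul_iff_left (by positivity)).1 this)
  have h4 : (n : ℤ) ∣ ((q / n : ℕ) : ℤ) - 1 := by
    obtain ⟨t, ht⟩ := h1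
    have : (q : ℤ) / n = r ^ e * n * t + 1 := by
      have hn0 : (n : ℤ) > 0 := by positivity
      rw [Int.ediv_eq_iff_of_pos hn0]
      rw [hM] at ht; push_cast at ht
      constructor <;> nlinarith
    push_cast
    rw [this]
    exact ⟨r ^ e * t, by ring⟩
  have h5 := h.dvd
  have h6 : (n : ℤ) ∣ B * (C - 1) := by
    have := dvd_sub (dvd_mul_of_dvd_right (dvd_sub h4 h5) (B : ℤ)) h3
    ring_nf at this ⊢
    exact this
  -- compute C
  obtain ⟨s, rfl⟩ : ∃ s, r = s + 1 := ⟨r - 1, by omega⟩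
  obtain ⟨P, hP⟩ : ∃ P : ℕ, P = (n + 1).ascFactorial s := ⟨_, rfl⟩
  have hP1 : (n : ℤ) ∣ (P : ℤ) - s.factorial := by
    have := Polynomial.sub_dvd_eval_sub ((n + 1 : ℕ) : ℤ) ((1 : ℕ) : ℤ) (ascPochhammer ℤ s)
    rw [← ascPochhammer_eval_cast, ← ascPochhammer_eval_cast, ascPochhammer_nat_eq_ascFactorial,
      ascPochhammer_nat_eq_ascFactorial, Nat.one_ascFactorial, ← hP] at this
    simpa using this
  have hC1 : ((s + 2 : ℤ)) * s.factorial * C = (n + s + 2) * (n' + 1) * P := by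
    have h7 := Nat.ascFactorial_eq_factorial_mul_choose n (s + 2)
    rw [show s + 2 = s + 1 + 1 from rfl, Nat.ascFactorial_succ, Nat.ascFactorial_succ, ← hP,
      Nat.factorial_succ, Nat.factorial_succ, Nat.choose_symm_add.symm] at h7
    rw [hC, show n + (s + 1) + 1 = n + (s + 1 + 1) from rfl]
    have h8 : ((n : ℤ)) = (s + 1) * n' := by exact_mod_cast hn'
    zify at h7
    have hs : (s + 1 : ℤ) ≠ 0 := by positivity
    apply mul_left_cancel₀ hs
    linear_combination -h7 + (n + s + 2) * P * h8
  have h9 : (n : ℤ) ∣ ((s + 2 : ℤ)) * s.factorial * (C - 1 - n') := by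
    obtain ⟨y, hy⟩ := hP1
    refine ⟨(n' + 1) * P + (s + 2) * (n' + 1) * y, ?_⟩
    linear_combination hC1 + (s + 2) * (n' + 1) * hy
  have h10 : (n : ℤ) ∣ B * (s + 2) * s.factorial * n' := by
    have := dvd_sub (dvd_mul_of_dvd_right h6 ((s + 2 : ℤ) * s.factorial))
      (dvd_mul_of_dvd_right h9 (B : ℤ))
    obtain ⟨y, hy⟩ := this
    exact ⟨y, by linear_combination hy⟩
  have h11 : n ∣ B * (s + 2) * s.factorial * n' := by exact_mod_cast h10
  have hn'0 : 0 < n' := Nat.pos_of_ne_zero (by rintro rfl; omega)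
  rw [hn'] at h11
  have h12 := Nat.dvd_of_mul_dvd_mul_right hn'0 h11
  rcases hrp.dvd_mul.1 h12 with h | h
  · rcases hrp.dvd_mul.1 h with h | h
    · exact hB h
    · have := (Nat.dvd_add_right (dvd_refl (s + 1))).1 (show s + 1 ∣ s + 1 + 1 from h)
      exact hrp.one_lt.ne' (Nat.dvd_one.1 this)
  · have := (hrp.dvd_factorial).1 h
    omega

theorem exists_prime_choose_not_modEq_of_composite
    (p : ℕ) (hp : 1 < p) (hnp : ¬ p.Prime) :
    ∃ q : ℕ, q.Prime ∧
      ¬ ((q.choose p : ℤ) ≡ ((q / p : ℕ) : ℤ) [ZMOD (p : ℤ)]) := by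
  by_cases he : Even p
  · refine even_case_aux p ?_ he
    rcases (by omega : p = 2 ∨ 2 < p) with h | h
    · subst h; exact absurd Nat.prime_two hnp
    · exact h
  · exact odd_case_aux p hp hnp he
end

section
/- Let p > 1 be an even composite natural number and l(p) = p · ∏_{r prime, r ∣ p} r^{⌊log_r p⌋}. Then for every positive natural number k, C(k·l(p) − 1, p) ≡ 1 (mod p) while ⌊(k·l(p) − 1)/p⌋ ≡ −1 (mod p); in particular C(k·l(p) − 1, p) is not congruent to ⌊(k·l(p) − 1)/p⌋ modulo p. -/
theorem aux_dvd_choose (p : ℕ) (hp : 1 < p) (k i : ℕ) (hi : 0 < i) (hip : i ≤ p)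
    (N : ℕ) (hN : N = k * (p * ∏ r ∈ p.primeFactors, r ^ Nat.log r p)) (hN0 : 0 < N) :
    p ∣ N.choose i := by
  rw [Nat.dvd_iff_prime_pow_dvd_dvd]
  intro r e hr hre
  rcases Nat.eq_zero_or_pos e with rfl | he
  · simp
  have hrp : r ∣ p := (dvd_pow_self r he.ne').trans hre
  have hmem : r ∈ p.primeFactors := Nat.mem_primeFactors.2 ⟨hr, hrp, by omega⟩
  have h1 : r ^ Nat.log r p ∣ ∏ r ∈ p.primeFactors, r ^ Nat.log r p :=
    Finset.dvd_prod_of_mem (fun r => r ^ Nat.log r p) hmem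
  have h2 : r ^ e * r ^ Nat.log r p ∣ N := by
    rw [hN]; exact Dvd.dvd.mul_left (mul_dvd_mul hre h1) k
  obtain ⟨a, u, hu, hiu⟩ := Nat.exists_eq_pow_mul_and_not_dvd hi.ne' r hr.ne_one
  have hrai : r ^ a ≤ p := (Nat.le_of_dvd hi ⟨u, hiu⟩).trans hip
  have ha : a ≤ Nat.log r p := Nat.le_log_of_pow_le hr.one_lt hrai
  have h3 : r ^ e * r ^ a ∣ N := (mul_dvd_mul_left _ (pow_dvd_pow r ha)).trans h2
  have h4 : N ∣ N.choose i * i := by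
    obtain ⟨n, rfl⟩ : ∃ n, N = n + 1 := ⟨N - 1, by omega⟩
    obtain ⟨j, rfl⟩ : ∃ j, i = j + 1 := ⟨i - 1, by omega⟩
    exact ⟨_, (Nat.add_one_mul_choose_eq n j).symm⟩
  have h5 : r ^ a * r ^ e ∣ r ^ a * (u * N.choose i) := by
    have := h3.trans h4
    rw [mul_comm (r ^ a) (r ^ e)]
    have e2 : r ^ a * (u * N.choose i) = N.choose i * i := by
      rw [← mul_assoc, ← hiu, mul_comm]
    rw [e2]
    exact this
  have h6 := Nat.dvd_of_mul_dvd_mul_left (pow_pos hr.pos a) h5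
  exact (((Nat.Prime.coprime_iff_not_dvd hr).2 hu).pow_left e).dvd_of_dvd_mul_left h6

theorem even_composite_counterexamples
    (p : ℕ) (hp : 1 < p) (hpe : Even p) (hnp : ¬ p.Prime)
    (l : ℕ) (hl : l = p * ∏ r ∈ p.primeFactors, r ^ Nat.log r p)
    (k : ℕ) (hk : 0 < k) :
    (((k * l - 1).choose p : ℤ) ≡ 1 [ZMOD (p : ℤ)]) ∧
    ((((k * l - 1) / p : ℕ) : ℤ) ≡ -1 [ZMOD (p : ℤ)]) ∧
    ¬ (((k * l - 1).choose p : ℤ) ≡ (((k * l - 1) / p : ℕ) : ℤ) [ZMOD (p : ℤ)]) := by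
  have hM : 0 < ∏ r ∈ p.primeFactors, r ^ Nat.log r p :=
    Finset.prod_pos fun r hr => pow_pos (Nat.prime_of_mem_primeFactors hr).pos _
  have hpM : p ∣ ∏ r ∈ p.primeFactors, r ^ Nat.log r p := by
    conv_lhs => rw [← Nat.prod_factorization_pow_eq_self (n := p) (by omega)]
    rw [Finsupp.prod, Nat.support_factorization]
    refine Finset.prod_dvd_prod_of_dvd _ _ fun r hr => pow_dvd_pow r ?_
    exact Nat.le_log_of_pow_le (Nat.prime_of_mem_primeFactors hr).one_lt
      (Nat.le_of_dvd (by omega) (Nat.ordProj_dvd p r))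
  have hN0 : 0 < k * l := by rw [hl]; positivity
  have key : ∀ i ≤ p, (((k * l - 1).choose i : ℤ) ≡ (-1) ^ i [ZMOD (p : ℤ)]) := by
    intro i
    induction i with
    | zero => intro _; simp
    | succ j ih =>
      intro hj
      have h := ih (by omega)
      have hd := aux_dvd_choose p hp k (j + 1) (by omega) hj (k * l) (by rw [hl]) hN0
      obtain ⟨n, hn⟩ : ∃ n, k * l = n + 1 := ⟨k * l - 1, by omega⟩
      rw [hn] at hd h ⊢
      simp only [Nat.add_sub_cancel] at h ⊢
      rw [Nat.choose_succ_succ] at hd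
      rw [Int.modEq_iff_dvd] at h ⊢
      have hd' : (p : ℤ) ∣ (n.choose j : ℤ) + (n.choose (j + 1) : ℤ) := by exact_mod_cast hd
      have e : (-1 : ℤ) ^ (j + 1) - (n.choose (j + 1) : ℤ)
        = - ((n.choose j : ℤ) + (n.choose (j + 1) : ℤ)) - ((-1) ^ j - (n.choose j : ℤ)) := by ring
      rw [e]
      exact dvd_sub (hd'.neg_right) h
  have c1 : (((k * l - 1).choose p : ℤ) ≡ 1 [ZMOD (p : ℤ)]) := by
    have := key p le_rfl
    rwa [hpe.neg_one_pow] at this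
  have c2 : ((((k * l - 1) / p : ℕ) : ℤ) ≡ -1 [ZMOD (p : ℤ)]) := by
    obtain ⟨m, hm⟩ := hpM
    have hkm : 0 < p * (k * m) := by
      have : 0 < m := Nat.pos_of_ne_zero (by rintro rfl; simp [hm] at hM)
      positivity
    have e : (k * l - 1) / p = p * (k * m) - 1 := by
      have : k * l = p * (p * (k * m)) := by rw [hl, hm]; ring
      rw [this]
      obtain ⟨t, ht⟩ : ∃ t, p * (k * m) = t + 1 := ⟨p * (k * m) - 1, by omega⟩
      rw [ht, Nat.add_sub_cancel]
      have : p * (t + 1) - 1 = (p - 1) + p * t := by rw [mul_add]; omega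
      rw [this, Nat.add_mul_div_left _ _ (by omega), Nat.div_eq_of_lt (by omega)]
      simp
    rw [e, Int.modEq_iff_dvd, Nat.cast_sub hkm]
    push_cast
    exact ⟨-(k * m), by ring⟩
  refine ⟨c1, c2, fun h => hnp ?_⟩
  have h2 := (c1.symm.trans h).trans c2
  rw [Int.modEq_iff_dvd] at h2
  have h3 : (p : ℤ) ∣ 2 := by simpa using h2.neg_right
  have h4 : p ∣ 2 := by exact_mod_cast h3
  have : p = 2 := by have := Nat.le_of_dvd (by norm_num) h4; omega
  rw [this]; exact Nat.prime_two
end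

section
/- Let p > 1 be an odd composite natural number and let r be the smallest prime divisor of p. Then C(p + r + 1, p) is not congruent to ⌊(p + r + 1)/p⌋ modulo p. -/
theorem asc_cast_aux (p k : ℕ) :
    (((p + 1).ascFactorial k : ℕ) : ZMod p) = ((k.factorial : ℕ) : ZMod p) := by
  induction k with
  | zero => simp
  | succ k ih =>
    rw [Nat.ascFactorial_succ, Nat.factorial_succ, Nat.cast_mul, ih]
    push_cast
    simp
    ring

theorem odd_composite_choose_not_modEq
    (p : ℕ) (hp : 1 < p) (hpo : Odd p) (hnp : ¬ p.Prime)
    (r : ℕ) (hr : r = p.minFac) :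
    ¬ (((p + r + 1).choose p : ℤ) ≡ (((p + r + 1) / p : ℕ) : ℤ) [ZMOD (p : ℤ)]) := by
  intro h
  have hrp : r.Prime := hr ▸ Nat.minFac_prime (by omega)
  have hsq : r ^ 2 ≤ p := hr ▸ Nat.minFac_sq_le_self (by omega) hnp
  obtain ⟨m, hm⟩ : r ∣ p := hr ▸ Nat.minFac_dvd p
  have h2 := hrp.two_le
  have hlt : r + 1 < p := by nlinarith
  have hdiv : (p + r + 1) / p = 1 := by
    rw [Nat.div_eq_iff (by omega)]; omega
  rw [hdiv, ← ZMod.intCast_eq_intCast_iff] at h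
  have hsym : (p + r + 1).choose p = (p + r + 1).choose (r + 1) := by
    rw [add_assoc]; exact Nat.choose_symm_add
  rw [hsym] at h
  push_cast at h
  obtain ⟨s, rfl⟩ : ∃ s, r = s + 1 := ⟨r - 1, by omega⟩
  have e1 := Nat.add_one_mul_choose_eq (p + (s + 1)) (s + 1)
  have e2 := Nat.add_one_mul_choose_eq (p + s) s
  have e3 := Nat.ascFactorial_eq_factorial_mul_choose p s
  have e4 := asc_cast_aux p s
  have e5 : (p + s + 1).choose (s + 1) = (m + 1) * (p + s).choose s := by
    apply Nat.eq_of_mul_eq_mul_right (Nat.succ_pos s)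
    rw [← Nat.succ_eq_add_one s] at *
    rw [← e2]
    have : p + s + 1 = (m + 1) * (s + 1) := by
      simp only [Nat.succ_eq_add_one] at hm; nlinarith
    rw [this]; simp only [Nat.succ_eq_add_one]; ring
  have f1 := congrArg (Nat.cast : ℕ → ZMod p) e1
  have f3 := congrArg (Nat.cast : ℕ → ZMod p) e3
  rw [← add_assoc, e5] at f1
  rw [e4] at f3
  rw [← add_assoc] at h
  push_cast at f1 f3
  rw [h] at f1
  simp only [CharP.cast_eq_zero, zero_add] at f1
  have key : ((m * ((s + 1 + 1) * s.factorial) : ℕ) : ZMod p) = 0 := by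
    push_cast
    linear_combination (s.factorial : ZMod p) * f1 + ((s:ZMod p) + 1 + 1) * (m + 1) * f3
  rw [ZMod.natCast_eq_zero_iff] at key
  have hm0 : 0 < m := by
    rcases Nat.eq_zero_or_pos m with h0 | h0
    · subst h0; omega
    · exact h0
  have k2 : (s + 1) ∣ (s + 1 + 1) * s.factorial := by
    apply Nat.dvd_of_mul_dvd_mul_left hm0
    rw [mul_comm m (s+1), ← hm]; exact key
  rcases hrp.dvd_mul.1 k2 with k | k
  · have := (Nat.dvd_add_right (dvd_refl (s+1))).1 k
    have := Nat.le_of_dvd one_pos this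
    omega
  · have := (hrp.dvd_factorial).1 k
    omega
end
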